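/- arXiv:1805.09715 — 2 statements merged into one kernel-verified Lean document; each statement's English description precedes it below -/
import Mathlib

section
/- Let X be a compact metric space, μ a probability measure on the Borel σ-algebra of X, and 𝒰 an ultrafilter on ℕ. Let A, B : ℕ → Set X be sequences of Borel subsets of X determining the same UP-set, i.e., for every sequence x : ℕ → X one has ({n : x_n ∈ A_n} ∈ 𝒰 ↔ {n : x_n ∈ B_n} ∈ 𝒰). If the sequence n ↦ μ(A_n) tends to a along 𝒰 and the sequence n ↦ μ(B_n) tends to b along 𝒰, then a = b. (Hence the finitely additive ultrapower measure μ̂_𝒰(Λ) := 𝒰-lim_n μ(A_n) on UP-sets of Borel sets is well defined.) -/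
open MeasureTheory

/-- If every sequence that `𝒰`-belongs to `A` also `𝒰`-belongs to `B`, then `A n ⊆ B n`
for `𝒰`-almost every `n`. -/
theorem Ultrafilter.eventually_subset_of_forall_mem {ι X : Type*} [Nonempty X]
    (𝒰 : Ultrafilter ι) (A B : ι → Set X)
    (h : ∀ x : ι → X, {n | x n ∈ A n} ∈ 𝒰 → {n | x n ∈ B n} ∈ 𝒰) :
    ∀ᶠ n in (𝒰 : Filter ι), A n ⊆ B n := by
  by_contra hcon
  have hne : ∀ᶠ n in (𝒰 : Filter ι), ¬ A n ⊆ B n := Ultrafilter.eventually_not.2 hcon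
  have hex : ∀ n, ∃ x, ¬ A n ⊆ B n → x ∈ A n ∧ x ∉ B n := fun n => by
    by_cases hn : A n ⊆ B n
    · exact ⟨Classical.arbitrary X, fun hn' => absurd hn hn'⟩
    · obtain ⟨x, hx⟩ := Set.not_subset.1 hn
      exact ⟨x, fun _ => hx⟩
  choose x hx using hex
  have hxA : ∀ᶠ n in (𝒰 : Filter ι), x n ∈ A n := hne.mono fun n hn => (hx n hn).1
  have hxB : ∀ᶠ n in (𝒰 : Filter ι), x n ∈ B n := h x hxA
  obtain ⟨n, hn, hnB⟩ := (hne.and hxB).exists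
  exact (hx n hn).2 hnB

/-- The finitely additive ultrapower measure is well defined: if two
sequences of Borel sets determine the same UP-set, then the `𝒰`-limits of their
measures coincide. -/
theorem ultrapower_measure_well_defined
    {X : Type*} [MetricSpace X] [CompactSpace X]
    [MeasurableSpace X] [BorelSpace X]
    (μ : Measure X) [IsProbabilityMeasure μ]
    (𝒰 : Ultrafilter ℕ) (A B : ℕ → Set X)
    (hA : ∀ n, MeasurableSet (A n)) (hB : ∀ n, MeasurableSet (B n))
    (hsame : ∀ x : ℕ → X, {n | x n ∈ A n} ∈ 𝒰 ↔ {n | x n ∈ B n} ∈ 𝒰)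
    (a b : ℝ)
    (ha : Filter.Tendsto (fun n => (μ (A n)).toReal) (𝒰 : Filter ℕ) (nhds a))
    (hb : Filter.Tendsto (fun n => (μ (B n)).toReal) (𝒰 : Filter ℕ) (nhds b)) :
    a = b := by
  have : Nonempty X := nonempty_of_isProbabilityMeasure μ
  have hAB := 𝒰.eventually_subset_of_forall_mem A B fun x => (hsame x).1
  have hBA := 𝒰.eventually_subset_of_forall_mem B A fun x => (hsame x).2
  refine tendsto_nhds_unique (ha.congr' ?_) hb
  filter_upwards [hAB, hBA] with n h₁ h₂
  rw [h₁.antisymm h₂]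
end

section
/- Let X be a nonempty set, 𝒰 an ultrafilter on ℕ, μ a probability measure on a σ-algebra of subsets of X, and A, B : ℕ → Set X sequences of measurable subsets of X whose associated UP-sets are disjoint, i.e., there is no sequence x : ℕ → X with both {n : x_n ∈ A_n} ∈ 𝒰 and {n : x_n ∈ B_n} ∈ 𝒰. If n ↦ μ(A_n) tends to a along 𝒰 and n ↦ μ(B_n) tends to b along 𝒰, then n ↦ μ(A_n ∪ B_n) tends to a + b along 𝒰. (Finite additivity of the ultrapower measure μ̂_𝒰.) -/
open MeasureTheory

/-- If the UP-sets determined by `(A n)` and `(B n)` are disjoint, then `A n` and `B n` are disjoint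
for `𝒰`-almost every `n`. -/
theorem eventually_disjoint_of_disjoint_ultraproducts {ι X : Type*} [Nonempty X]
    {𝒰 : Ultrafilter ι} {A B : ι → Set X}
    (hdisj : ¬ ∃ x : ι → X, {n | x n ∈ A n} ∈ 𝒰 ∧ {n | x n ∈ B n} ∈ 𝒰) :
    ∀ᶠ n in (𝒰 : Filter ι), Disjoint (A n) (B n) := by
  by_contra h
  have hmeet : ∀ᶠ n in (𝒰 : Filter ι), ∃ y, y ∈ A n ∧ y ∈ B n :=
    (Ultrafilter.eventually_not.mpr h).mono fun n hn => Set.not_disjoint_iff.mp hn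
  obtain ⟨x, hx⟩ := hmeet.choice
  exact hdisj ⟨x, hx.mono fun n hn => hn.1, hx.mono fun n hn => hn.2⟩

/-- Finite additivity of the ultrapower measure: if the UP-sets
determined by `(A n)` and `(B n)` are disjoint, then the `𝒰`-limit of
`μ (A n ∪ B n)` is the sum of the `𝒰`-limits of `μ (A n)` and `μ (B n)`. -/
theorem ultrapower_measure_finitely_additive
    {X : Type*} [Nonempty X] [MeasurableSpace X]
    (μ : Measure X) [IsProbabilityMeasure μ]
    (𝒰 : Ultrafilter ℕ) (A B : ℕ → Set X)
    (hA : ∀ n, MeasurableSet (A n)) (hB : ∀ n, MeasurableSet (B n))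
    (hdisj : ¬ ∃ x : ℕ → X, {n | x n ∈ A n} ∈ 𝒰 ∧ {n | x n ∈ B n} ∈ 𝒰)
    (a b : ℝ)
    (ha : Filter.Tendsto (fun n => (μ (A n)).toReal) (𝒰 : Filter ℕ) (nhds a))
    (hb : Filter.Tendsto (fun n => (μ (B n)).toReal) (𝒰 : Filter ℕ) (nhds b)) :
    Filter.Tendsto (fun n => (μ (A n ∪ B n)).toReal) (𝒰 : Filter ℕ) (nhds (a + b)) := by
  refine (ha.add hb).congr' ?_
  filter_upwards [eventually_disjoint_of_disjoint_ultraproducts hdisj] with n hn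
  exact (measureReal_union hn (hB n)).symm
end
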